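/- arXiv:2509.15398 — 11 statements merged into one kernel-verified Lean document; each statement's English description precedes it below -/
import Mathlib

section
/- Let S be a commutative semiring with 1 ≠ 0 and M a unital S-semimodule. If M has a 1-absorbing prime subsemimodule that is not prime, then S is a local semiring. -/
open Submodule

/-- The ideal `(N :_S M) = {s : S | s • M ⊆ N}`. -/
def colonSM {S M : Type*} [CommSemiring S] [AddCommMonoid M] [Module S M]
    (N : Submodule S M) : Ideal S where
  carrier := {s : S | ∀ m : M, s • m ∈ N}
  add_mem' := by
    intro a b ha hb m
    rw [add_smul]
    exact N.add_mem (ha m) (hb m)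
  zero_mem' := by
    intro m
    rw [zero_smul]
    exact N.zero_mem
  smul_mem' := by
    intro c s hs m
    rw [smul_eq_mul, mul_smul]
    exact N.smul_mem c (hs m)

/-- A prime subsemimodule: a proper subsemimodule `N` such that `a • m ∈ N` implies
`a ∈ (N :_S M)` or `m ∈ N`. -/
def IsPrimeSubmodule {S M : Type*} [CommSemiring S] [AddCommMonoid M] [Module S M]
    (N : Submodule S M) : Prop :=
  N ≠ ⊤ ∧ ∀ (a : S) (m : M), a • m ∈ N → a ∈ colonSM N ∨ m ∈ N

/-- A `1`-absorbing prime subsemimodule: a proper subsemimodule `N` such that for all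
nonunits `a b : S` and `m : M`, `(a * b) • m ∈ N` implies `a * b ∈ (N :_S M)` or `m ∈ N`. -/
def IsOneAbsorbingPrimeSubmodule {S M : Type*} [CommSemiring S] [AddCommMonoid M] [Module S M]
    (N : Submodule S M) : Prop :=
  N ≠ ⊤ ∧ ∀ a b : S, ¬ IsUnit a → ¬ IsUnit b → ∀ m : M,
    (a * b) • m ∈ N → a * b ∈ colonSM N ∨ m ∈ N

/-- A weakly `1`-absorbing prime subsemimodule: a proper subsemimodule `N` such that for all
nonunits `a b : S` and `m : M`, `0 ≠ (a * b) • m ∈ N` implies `a * b ∈ (N :_S M)` or `m ∈ N`. -/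
def IsWeaklyOneAbsorbingPrimeSubmodule {S M : Type*} [CommSemiring S] [AddCommMonoid M]
    [Module S M] (N : Submodule S M) : Prop :=
  N ≠ ⊤ ∧ ∀ a b : S, ¬ IsUnit a → ¬ IsUnit b → ∀ m : M,
    (a * b) • m ∈ N → (a * b) • m ≠ 0 → a * b ∈ colonSM N ∨ m ∈ N

/-- A `1`-absorbing prime ideal: a proper ideal `I` such that for all nonunits `a b c : S`,
`a * b * c ∈ I` implies `a * b ∈ I` or `c ∈ I`. -/
def IsOneAbsorbingPrimeIdeal {S : Type*} [CommSemiring S] (I : Ideal S) : Prop :=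
  I ≠ ⊤ ∧ ∀ a b c : S, ¬ IsUnit a → ¬ IsUnit b → ¬ IsUnit c →
    a * b * c ∈ I → a * b ∈ I ∨ c ∈ I

/-- A weakly `1`-absorbing prime ideal: a proper ideal `I` such that for all nonunits
`a b c : S`, `0 ≠ a * b * c ∈ I` implies `a * b ∈ I` or `c ∈ I`. -/
def IsWeaklyOneAbsorbingPrimeIdeal {S : Type*} [CommSemiring S] (I : Ideal S) : Prop :=
  I ≠ ⊤ ∧ ∀ a b c : S, ¬ IsUnit a → ¬ IsUnit b → ¬ IsUnit c →
    a * b * c ∈ I → a * b * c ≠ 0 → a * b ∈ I ∨ c ∈ I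

/-- A local semiring: the sum of any two nonunits is a nonunit. -/
def IsLocalSemiring (S : Type*) [CommSemiring S] : Prop :=
  ∀ a b : S, ¬ IsUnit a → ¬ IsUnit b → ¬ IsUnit (a + b)

/-- A subtractive subsemimodule: `x ∈ N` and `x + y ∈ N` imply `y ∈ N`. -/
def Subtractive {S M : Type*} [CommSemiring S] [AddCommMonoid M] [Module S M]
    (N : Submodule S M) : Prop :=
  ∀ x y : M, x ∈ N → x + y ∈ N → y ∈ N

/-- A strong subsemimodule: every element of `N` has an additive inverse in `N`. -/
def StrongSubmodule {S M : Type*} [CommSemiring S] [AddCommMonoid M] [Module S M]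
    (N : Submodule S M) : Prop :=
  ∀ x ∈ N, ∃ y ∈ N, x + y = 0

/-- A multiplication semimodule: every subsemimodule has the form `I • M` for an ideal `I`. -/
def IsMultiplicationSemimodule (S M : Type*) [CommSemiring S] [AddCommMonoid M]
    [Module S M] : Prop :=
  ∀ N : Submodule S M, ∃ I : Ideal S, N = I • (⊤ : Submodule S M)

/-- A multiplicatively cancellative (MC) semimodule: `s • x = t • x` with `x ≠ 0`
implies `s = t`. -/
def IsMC (S M : Type*) [CommSemiring S] [AddCommMonoid M] [Module S M] : Prop :=
  ∀ (s t : S) (x : M), x ≠ 0 → s • x = t • x → s = t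

/-- If `M` has a `1`-absorbing prime subsemimodule that is not prime,
then `S` is a local semiring. -/
theorem isLocalSemiring_of_exists_oneAbsorbingPrime_not_prime
    {S M : Type*} [CommSemiring S] [Nontrivial S] [AddCommMonoid M] [Module S M]
    (h : ∃ N : Submodule S M, IsOneAbsorbingPrimeSubmodule N ∧ ¬ IsPrimeSubmodule N) :
    IsLocalSemiring S := by
  obtain ⟨N, ⟨hN, habs⟩, hnp⟩ := h
  have hex : ∃ (a : S) (m : M), a • m ∈ N ∧ a ∉ colonSM N ∧ m ∉ N := by
    by_contra! hc
    exact hnp ⟨hN, fun a m ham => or_iff_not_imp_left.2 (hc a m ham)⟩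
  obtain ⟨a, m, ham, ha, hm⟩ := hex
  have hau : ¬ IsUnit a := fun hu => hm ((N.smul_mem_iff_of_isUnit hu).1 ham)
  have hmul : ∀ x : S, ¬ IsUnit x → x * a ∈ colonSM N := fun x hx =>
    (habs x a hx hau m (by rw [mul_smul]; exact N.smul_mem x ham)).resolve_right hm
  intro x y hx hy hxy
  refine ha ((Ideal.unit_mul_mem_iff_mem _ hxy).1 ?_)
  rw [add_mul]
  exact (colonSM N).add_mem (hmul x hx) (hmul y hy)
end

section
/- Let S be a non-local commutative semiring with 1 ≠ 0 and M a unital S-semimodule. A proper subsemimodule N of M is 1-absorbing prime if and only if it is prime. -/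
open Submodule

/-- Over a non-local semiring, a proper subsemimodule is `1`-absorbing prime
if and only if it is prime. -/
theorem isOneAbsorbingPrimeSubmodule_iff_isPrimeSubmodule_of_not_local
    {S M : Type*} [CommSemiring S] [Nontrivial S] [AddCommMonoid M] [Module S M]
    (hS : ¬ IsLocalSemiring S) (N : Submodule S M) (hN : N ≠ ⊤) :
    IsOneAbsorbingPrimeSubmodule N ↔ IsPrimeSubmodule N := by
  refine ⟨fun h => ⟨hN, fun a m ham => ?_⟩, fun h => ⟨hN, fun a b _ _ m => h.2 (a * b) m⟩⟩
  by_cases ha : IsUnit a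
  · exact .inr ((N.smul_mem_iff_of_isUnit ha).1 ham)
  by_cases hm : m ∈ N
  · exact .inr hm
  have mul_mem_colon : ∀ s : S, ¬ IsUnit s → a * s ∈ colonSM N := fun s hs =>
    (h.2 a s ha hs m (by rw [mul_comm, mul_smul]; exact N.smul_mem s ham)).resolve_right hm
  simp only [IsLocalSemiring, not_forall, not_not] at hS
  obtain ⟨b, c, hb, hc, hbc⟩ := hS
  refine .inl (((colonSM N).mul_unit_mem_iff_mem hbc).1 ?_)
  rw [mul_add]
  exact (colonSM N).add_mem (mul_mem_colon b hb) (mul_mem_colon c hc)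
end

section
/- Let S be a commutative semiring with 1 ≠ 0 and M a unital S-semimodule. If N is a 1-absorbing prime subsemimodule of M, then (N :_S M) is a 1-absorbing prime ideal of S. -/
open Submodule

/-- If `N` is a `1`-absorbing prime subsemimodule of `M`, then `(N :_S M)` is a
`1`-absorbing prime ideal of `S`. -/
theorem colonSM_isOneAbsorbingPrimeIdeal
    {S M : Type*} [CommSemiring S] [Nontrivial S] [AddCommMonoid M] [Module S M]
    (N : Submodule S M) (hN : IsOneAbsorbingPrimeSubmodule N) :
    IsOneAbsorbingPrimeIdeal (colonSM N) := by
  refine ⟨fun h => hN.1 (eq_top_iff.2 fun m _ => ?_), fun a b c ha hb _ habc => ?_⟩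
  · have h1 : ∀ m : M, (1 : S) • m ∈ N := (Ideal.eq_top_iff_one _).1 h
    simpa using h1 m
  · refine or_iff_not_imp_left.2 fun hab m => ?_
    refine (hN.2 a b ha hb (c • m) ?_).resolve_left hab
    rw [← mul_smul]
    exact habc m
end

section
/- Let S be a commutative semiring with 1 ≠ 0, M a unital S-semimodule, and N a proper subsemimodule of M. Then N is a 1-absorbing prime subsemimodule of M if and only if for all proper ideals I, J of S and every subsemimodule K of M with I • (J • K) ⊆ N, either the ideal I*J ⊆ (N :_S M) or K ⊆ N. -/
open Submodule

/-- A proper subsemimodule `N` is `1`-absorbing prime if and only if for all proper ideals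
`I, J` of `S` and every subsemimodule `K` of `M` with `I • (J • K) ⊆ N`, either
`I * J ⊆ (N :_S M)` or `K ⊆ N`. -/
theorem isOneAbsorbingPrimeSubmodule_iff_ideal_ideal_submodule
    {S M : Type*} [CommSemiring S] [Nontrivial S] [AddCommMonoid M] [Module S M]
    (N : Submodule S M) (hN : N ≠ ⊤) :
    IsOneAbsorbingPrimeSubmodule N ↔
      ∀ I J : Ideal S, I ≠ ⊤ → J ≠ ⊤ → ∀ K : Submodule S M,
        I • (J • K) ≤ N → I * J ≤ colonSM N ∨ K ≤ N := by
  constructor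
  · rintro ⟨-, h⟩ I J hI hJ K hK
    refine or_iff_not_imp_right.mpr fun hKN => ?_
    obtain ⟨k, hk, hkN⟩ := SetLike.not_le_iff_exists.mp hKN
    refine Ideal.mul_le.mpr fun a ha b hb => ?_
    have habk : (a * b) • k ∈ N := by
      rw [mul_smul]
      exact hK (smul_mem_smul ha (smul_mem_smul hb hk))
    exact (h a b (fun hu => hI (I.eq_top_of_isUnit_mem ha hu))
      (fun hu => hJ (J.eq_top_of_isUnit_mem hb hu)) k habk).resolve_right hkN
  · intro h
    refine ⟨hN, fun a b ha hb m hm => ?_⟩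
    have hle : Ideal.span {a} • (Ideal.span {b} • span S {m}) ≤ N := by
      rw [← Submodule.mul_smul, Ideal.span_singleton_mul_span_singleton, Ideal.span,
        span_smul_span]
      simpa [span_le] using hm
    refine (h _ _ (mt Ideal.span_singleton_eq_top.mp ha) (mt Ideal.span_singleton_eq_top.mp hb)
      _ hle).imp (fun hab => ?_) fun hmN => hmN (mem_span_singleton_self m)
    exact hab (Ideal.mul_mem_mul (Ideal.mem_span_singleton_self a)
      (Ideal.mem_span_singleton_self b))
end

section
/- Let S be a commutative semiring with 1 ≠ 0, M an MC multiplication S-semimodule, and I a 1-absorbing prime ideal of S. If a, b ∈ S are nonunits and x ∈ M satisfies (a*b) • x ∈ I • M, then a*b ∈ I or x ∈ I • M. -/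
open Submodule

/-- In an MC multiplication semimodule `M ≠ 0`, a proper ideal `Q` satisfies `Q • M ≠ M`. -/
theorem IsMC.smul_top_ne_top {S M : Type*} [CommSemiring S] [AddCommMonoid M] [Module S M]
    (hMC : IsMC S M) (hMul : IsMultiplicationSemimodule S M) {x : M} (hx : x ≠ 0)
    {Q : Ideal S} (hQ : Q ≠ ⊤) : Q • (⊤ : Submodule S M) ≠ ⊤ := by
  intro h
  obtain ⟨J, hJ⟩ := hMul (span S {x})
  have hspan : span S {x} = Q • span S {x} := by
    rw [hJ, ← mul_smul, mul_comm, mul_smul, h]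
  have hmem : x ∈ Q • span S {x} := hspan ▸ mem_span_singleton_self x
  obtain ⟨q, hq, hqx⟩ := mem_smul_span_singleton.1 hmem
  have hq1 : q = 1 := hMC q 1 x hx (by rw [hqx, one_smul])
  exact hQ ((Ideal.eq_top_iff_one Q).2 (hq1 ▸ hq))

/-- In a multiplication semimodule `M`, if `Q • M ≠ M` then there are a nonzero `m : M` and
`j ∉ Q` with `j • M ⊆ S m`. -/
theorem IsMultiplicationSemimodule.exists_smul_mem_span_singleton {S M : Type*} [CommSemiring S]
    [AddCommMonoid M] [Module S M] (hMul : IsMultiplicationSemimodule S M) {Q : Ideal S}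
    (hQ : Q • (⊤ : Submodule S M) ≠ ⊤) :
    ∃ m : M, m ≠ 0 ∧ ∃ j ∉ Q, ∀ y : M, j • y ∈ span S {m} := by
  obtain ⟨m, hm⟩ : ∃ m, m ∉ Q • (⊤ : Submodule S M) := by
    simpa [Submodule.eq_top_iff'] using hQ
  obtain ⟨J, hJ⟩ := hMul (span S {m})
  have hJQ : ¬ J ≤ Q := fun h =>
    hm (smul_mono_left h (hJ ▸ mem_span_singleton_self m))
  obtain ⟨j, hj, hjQ⟩ := SetLike.not_le_iff_exists.1 hJQ
  refine ⟨m, fun h => hm (h ▸ zero_mem _), j, hjQ, fun y => ?_⟩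
  rw [hJ]
  exact smul_mem_smul hj mem_top

/-- Let `M` be an MC multiplication semimodule and `I` a `1`-absorbing prime ideal of `S`.
If `(a * b) • x ∈ I • M` for nonunits `a, b` and `x ∈ M`, then `a * b ∈ I` or `x ∈ I • M`. -/
theorem mem_or_mem_of_smul_mem_ideal_smul_top
    {S M : Type*} [CommSemiring S] [Nontrivial S] [AddCommMonoid M] [Module S M]
    (hMC : IsMC S M) (hMul : IsMultiplicationSemimodule S M)
    (I : Ideal S) (hI : IsOneAbsorbingPrimeIdeal I)
    (a b : S) (ha : ¬ IsUnit a) (hb : ¬ IsUnit b) (x : M)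
    (hx : (a * b) • x ∈ I • (⊤ : Submodule S M)) :
    a * b ∈ I ∨ x ∈ I • (⊤ : Submodule S M) := by
  by_cases hx0 : x = 0
  · exact Or.inr (hx0 ▸ zero_mem _)
  refine or_iff_not_imp_left.2 fun hab => ?_
  by_contra hxI
  let K : Ideal S := (I • (⊤ : Submodule S M)).comap (LinearMap.toSpanSingleton S M x)
  have hK : K ≠ ⊤ := fun h => hxI (by
    simpa [K] using (Ideal.eq_top_iff_one K).1 h)
  obtain ⟨Q, hQ, hKQ⟩ := Ideal.exists_le_maximal K hK
  obtain ⟨m, hm, j, hjQ, hj⟩ := hMul.exists_smul_mem_span_singleton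
    (hMC.smul_top_ne_top hMul hx0 hQ.ne_top)
  obtain ⟨s, hs⟩ := mem_span_singleton.1 (hj x)
  have hjIM : ∀ y ∈ I • (⊤ : Submodule S M), j • y ∈ I • span S {m} := fun y hy => by
    induction hy using smul_induction_on' with
    | smul r hr n _ => rw [smul_comm]; exact smul_mem_smul hr (hj n)
    | add y _ z _ hy hz => rw [smul_add]; exact add_mem hy hz
  obtain ⟨i, hi, him⟩ := mem_smul_span_singleton.1 (hjIM _ hx)
  have habs : a * b * s = i := hMC _ _ m hm (by rw [mul_smul, hs, him, smul_comm])
  have habsI : a * b * s ∈ I := habs ▸ hi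
  by_cases hsu : IsUnit s
  · exact hab ((Ideal.mul_unit_mem_iff_mem I hsu).1 habsI)
  · have hsI : s ∈ I := (hI.2 a b s ha hb hsu habsI).resolve_left hab
    refine hjQ (hKQ ?_)
    change j • x ∈ I • (⊤ : Submodule S M)
    exact hs ▸ smul_mem_smul hsI mem_top
end

section
/- Let S be a commutative semiring with 1 ≠ 0, M₁ and M₂ unital S-semimodules, and f : M₁ → M₂ an S-semimodule homomorphism. If N₂ is a 1-absorbing prime subsemimodule of M₂ and the image of f is not contained in N₂, then the preimage f⁻¹(N₂) is a 1-absorbing prime subsemimodule of M₁. -/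
open Submodule

/-- If `N₂` is a `1`-absorbing prime subsemimodule of `M₂` and the image of `f : M₁ → M₂`
is not contained in `N₂`, then `f⁻¹(N₂)` is a `1`-absorbing prime subsemimodule of `M₁`. -/
theorem comap_isOneAbsorbingPrimeSubmodule
    {S M₁ M₂ : Type*} [CommSemiring S] [Nontrivial S]
    [AddCommMonoid M₁] [Module S M₁] [AddCommMonoid M₂] [Module S M₂]
    (f : M₁ →ₗ[S] M₂) (N₂ : Submodule S M₂)
    (hN₂ : IsOneAbsorbingPrimeSubmodule N₂)
    (hrange : ¬ LinearMap.range f ≤ N₂) :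
    IsOneAbsorbingPrimeSubmodule (N₂.comap f) := by
  refine ⟨fun h => hrange ?_, fun a b ha hb m hm => ?_⟩
  · rintro _ ⟨m, rfl⟩
    exact Submodule.mem_comap.mp (h ▸ Submodule.mem_top)
  · rw [Submodule.mem_comap, map_smul] at hm
    refine (hN₂.2 a b ha hb (f m) hm).imp (fun h x => ?_) id
    rw [Submodule.mem_comap, map_smul]
    exact h (f x)
end

section
/- Let S be a commutative semiring with 1 ≠ 0, M₁ and M₂ unital S-semimodules, and f : M₁ → M₂ a surjective S-semimodule homomorphism. If N₁ is a 1-absorbing prime subsemimodule of M₁ that is subtractive and strong, and the kernel of f (the preimage of 0) is contained in N₁, then the image f(N₁) is a 1-absorbing prime subsemimodule of M₂. -/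
open Submodule

/-- If `N` is subtractive and strong and contains the kernel of `f`, then `N` is saturated
with respect to `f`. -/
theorem comap_map_eq_of_subtractive_of_strong
    {S M₁ M₂ : Type*} [CommSemiring S] [AddCommMonoid M₁] [Module S M₁]
    [AddCommMonoid M₂] [Module S M₂] (f : M₁ →ₗ[S] M₂) (N : Submodule S M₁)
    (hsub : Subtractive N) (hstrong : StrongSubmodule N) (hker : LinearMap.ker f ≤ N) :
    (N.map f).comap f = N := by
  refine le_antisymm ?_ (le_comap_map f N)
  rintro x ⟨n, hn, hnx⟩
  obtain ⟨y, hy, hny⟩ := hstrong n hn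
  refine hsub y x hy (hker ?_)
  rw [LinearMap.mem_ker, map_add, ← hnx, ← map_add, add_comm, hny, map_zero]

/-- If `f : M₁ → M₂` is a surjective homomorphism, `N₁` is a `1`-absorbing prime subtractive
strong subsemimodule of `M₁`, and `ker f ⊆ N₁`, then `f(N₁)` is a `1`-absorbing prime
subsemimodule of `M₂`. -/
theorem map_isOneAbsorbingPrimeSubmodule
    {S M₁ M₂ : Type*} [CommSemiring S] [Nontrivial S]
    [AddCommMonoid M₁] [Module S M₁] [AddCommMonoid M₂] [Module S M₂]
    (f : M₁ →ₗ[S] M₂) (hf : Function.Surjective f) (N₁ : Submodule S M₁)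
    (hN₁ : IsOneAbsorbingPrimeSubmodule N₁) (hsub : Subtractive N₁)
    (hstrong : StrongSubmodule N₁)
    (hker : LinearMap.ker f ≤ N₁) :
    IsOneAbsorbingPrimeSubmodule (N₁.map f) := by
  have hcomap := comap_map_eq_of_subtractive_of_strong f N₁ hsub hstrong hker
  have hmem (x : M₁) : f x ∈ N₁.map f ↔ x ∈ N₁ := by rw [← mem_comap, hcomap]
  refine ⟨fun htop => hN₁.1 ?_, fun a b ha hb m hm => ?_⟩
  · rw [← hcomap, htop, comap_top]
  · obtain ⟨x, rfl⟩ := hf m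
    rw [← map_smul, hmem] at hm
    refine (hN₁.2 a b ha hb x hm).imp (fun hab m => ?_) (hmem x).2
    obtain ⟨z, rfl⟩ := hf m
    rw [← map_smul, hmem]
    exact hab z
end

section
/- Let S be a commutative semiring with 1 ≠ 0, M a unital S-semimodule, and N a proper subtractive subsemimodule of M. Then N is a weakly 1-absorbing prime subsemimodule of M if and only if for all proper ideals I, J of S and every subsemimodule K of M with I • (J • K) ⊆ N and I • (J • K) ≠ 0, either the ideal I*J ⊆ (N :_S M) or K ⊆ N. -/
open Submodule

theorem Subtractive.colonSM_add_right {S M : Type*} [CommSemiring S] [AddCommMonoid M]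
    [Module S M] {N : Submodule S M} (hsub : Subtractive N) {s t : S}
    (hs : s ∈ colonSM N) (hst : s + t ∈ colonSM N) : t ∈ colonSM N := fun m =>
  hsub (s • m) (t • m) (hs m) (by rw [← add_smul]; exact hst m)

namespace IsWeaklyOneAbsorbingPrimeSubmodule

variable {S M : Type*} [CommSemiring S] [AddCommMonoid M] [Module S M] {N : Submodule S M}

theorem mem_colonSM_or_le (h : IsWeaklyOneAbsorbingPrimeSubmodule N) (hsub : Subtractive N)
    {a b : S} (ha : ¬ IsUnit a) (hb : ¬ IsUnit b) {K : Submodule S M}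
    (hK : ∀ k ∈ K, (a * b) • k ∈ N) (hne : ∃ k ∈ K, (a * b) • k ≠ 0) :
    a * b ∈ colonSM N ∨ K ≤ N := by
  refine or_iff_not_imp_left.2 fun hab x hx => ?_
  by_cases hx0 : (a * b) • x = 0
  · obtain ⟨y, hy, hy0⟩ := hne
    have hyN : y ∈ N := (h.2 a b ha hb y (hK y hy) hy0).resolve_left hab
    have hyx : (a * b) • (y + x) ≠ 0 := by rwa [smul_add, hx0, add_zero]
    exact hsub y x hyN
      ((h.2 a b ha hb (y + x) (hK _ (K.add_mem hy hx)) hyx).resolve_left hab)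
  · exact (h.2 a b ha hb x (hK x hx) hx0).resolve_left hab

theorem forall_mul_mem_colonSM_or_le (h : IsWeaklyOneAbsorbingPrimeSubmodule N)
    (hsub : Subtractive N) {a : S} (ha : ¬ IsUnit a) {J : Ideal S} (hJ : J ≠ ⊤)
    {K : Submodule S M} (hK : ∀ b ∈ J, ∀ k ∈ K, (a * b) • k ∈ N)
    (hne : ∃ b ∈ J, ∃ k ∈ K, (a * b) • k ≠ 0) :
    (∀ b ∈ J, a * b ∈ colonSM N) ∨ K ≤ N := by
  refine or_iff_not_imp_right.2 fun hKN b hb => ?_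
  have key : ∀ c ∈ J, (∃ k ∈ K, (a * c) • k ≠ 0) → a * c ∈ colonSM N := fun c hc hc0 =>
    (h.mem_colonSM_or_le hsub ha (fun hu => hJ (J.eq_top_of_isUnit_mem hc hu))
      (hK c hc) hc0).resolve_right hKN
  by_cases hb0 : ∃ k ∈ K, (a * b) • k ≠ 0
  · exact key b hb hb0
  · push Not at hb0
    obtain ⟨c, hc, k, hk, hck⟩ := hne
    refine hsub.colonSM_add_right (key c hc ⟨k, hk, hck⟩) ?_
    rw [← mul_add]
    refine key (c + b) (J.add_mem hc hb) ⟨k, hk, ?_⟩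
    rwa [mul_add, add_smul, hb0 k hk, add_zero]

theorem mul_le_colonSM_or_le (h : IsWeaklyOneAbsorbingPrimeSubmodule N) (hsub : Subtractive N)
    {I J : Ideal S} (hI : I ≠ ⊤) (hJ : J ≠ ⊤) {K : Submodule S M}
    (hK : ∀ a ∈ I, ∀ b ∈ J, ∀ k ∈ K, (a * b) • k ∈ N)
    (hne : ∃ a ∈ I, ∃ b ∈ J, ∃ k ∈ K, (a * b) • k ≠ 0) :
    I * J ≤ colonSM N ∨ K ≤ N := by
  refine or_iff_not_imp_right.2 fun hKN => Ideal.mul_le.2 fun a ha b hb => ?_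
  have key : ∀ c ∈ I, (∃ b ∈ J, ∃ k ∈ K, (c * b) • k ≠ 0) → ∀ b ∈ J, c * b ∈ colonSM N :=
    fun c hc hc0 =>
      (h.forall_mul_mem_colonSM_or_le hsub (fun hu => hI (I.eq_top_of_isUnit_mem hc hu)) hJ
        (hK c hc) hc0).resolve_right hKN
  by_cases ha0 : ∃ b ∈ J, ∃ k ∈ K, (a * b) • k ≠ 0
  · exact key a ha ha0 b hb
  · push Not at ha0
    obtain ⟨c, hc, d, hd, k, hk, hdk⟩ := hne
    refine hsub.colonSM_add_right (key c hc ⟨d, hd, k, hk, hdk⟩ b hb) ?_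
    rw [← add_mul]
    refine key (c + a) (I.add_mem hc ha) ⟨d, hd, k, hk, ?_⟩ b hb
    rwa [add_mul, add_smul, ha0 d hd k hk, add_zero]

end IsWeaklyOneAbsorbingPrimeSubmodule

theorem smul_smul_submodule_le_iff {S M : Type*} [CommSemiring S] [AddCommMonoid M]
    [Module S M] {I J : Ideal S} {K N : Submodule S M} :
    I • (J • K) ≤ N ↔ ∀ a ∈ I, ∀ b ∈ J, ∀ k ∈ K, (a * b) • k ∈ N := by
  refine ⟨fun h a ha b hb k hk => h ?_, fun h => ?_⟩
  · rw [mul_smul]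
    exact smul_mem_smul ha (smul_mem_smul hb hk)
  · rw [← Submodule.mul_smul, smul_le]
    intro r hr k hk
    have hIJ : I * J ≤ N.comap (LinearMap.toSpanSingleton S M k) :=
      Ideal.mul_le.2 fun a ha b hb => h a ha b hb k hk
    exact hIJ hr

/-- A proper subtractive subsemimodule `N` is weakly `1`-absorbing prime if and only if for
all proper ideals `I, J` of `S` and every subsemimodule `K` of `M` with
`0 ≠ I • (J • K) ⊆ N`, either `I * J ⊆ (N :_S M)` or `K ⊆ N`. -/
theorem isWeaklyOneAbsorbingPrimeSubmodule_iff_ideal_ideal_submodule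
    {S M : Type*} [CommSemiring S] [Nontrivial S] [AddCommMonoid M] [Module S M]
    (N : Submodule S M) (hN : N ≠ ⊤) (hsub : Subtractive N) :
    IsWeaklyOneAbsorbingPrimeSubmodule N ↔
      ∀ I J : Ideal S, I ≠ ⊤ → J ≠ ⊤ → ∀ K : Submodule S M,
        I • (J • K) ≤ N → I • (J • K) ≠ ⊥ → I * J ≤ colonSM N ∨ K ≤ N := by
  refine ⟨fun h I J hI hJ K hle hne => ?_, fun h => ⟨hN, fun a b ha hb m hm hm0 => ?_⟩⟩
  · refine h.mul_le_colonSM_or_le hsub hI hJ (smul_smul_submodule_le_iff.1 hle) ?_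
    by_contra! h0
    exact hne (le_bot_iff.1 (smul_smul_submodule_le_iff.2 h0))
  · have hspan : Ideal.span {a} • (Ideal.span {b} • span S {m}) = span S {(a * b) • m} := by
      simp only [Ideal.span, span_smul_span, Set.singleton_smul_singleton, mul_smul]
    rcases h (Ideal.span {a}) (Ideal.span {b}) (mt Ideal.span_singleton_eq_top.1 ha)
      (mt Ideal.span_singleton_eq_top.1 hb) (span S {m})
      (by rwa [hspan, span_singleton_le_iff_mem])
      (by rwa [hspan, Ne, span_singleton_eq_bot]) with hab | hmN
    · exact .inl (hab (Ideal.mul_mem_mul (Ideal.mem_span_singleton_self a)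
        (Ideal.mem_span_singleton_self b)))
    · exact .inr (hmN (mem_span_singleton_self m))
end

section
/- Let S be a commutative semiring with 1 ≠ 0, M an MC multiplication S-semimodule, and I a weakly 1-absorbing prime ideal of S. If a, b ∈ S are nonunits and x ∈ M satisfies (a*b) • x ∈ I • M and (a*b) • x ≠ 0, then a*b ∈ I or x ∈ I • M. -/
open Submodule

/-- The elements `t : S` such that `t • M` is contained in a cyclic subsemimodule. -/
def cyclicMultipliers (S M : Type*) [CommSemiring S] [AddCommMonoid M] [Module S M] : Set S :=
  {t : S | ∃ m : M, ∀ y : M, t • y ∈ span S {m}}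

theorem IsMultiplicationSemimodule.span_cyclicMultipliers_smul_top
    {S M : Type*} [CommSemiring S] [AddCommMonoid M] [Module S M]
    (hMul : IsMultiplicationSemimodule S M) :
    Ideal.span (cyclicMultipliers S M) • (⊤ : Submodule S M) = ⊤ := by
  refine eq_top_iff.2 fun m _ => ?_
  obtain ⟨J, hJ⟩ := hMul (span S {m})
  have hm : m ∈ J • (⊤ : Submodule S M) := hJ ▸ mem_span_singleton_self m
  have hle : J ≤ Ideal.span (cyclicMultipliers S M) := fun t ht =>
    Ideal.subset_span ⟨m, fun y => hJ ▸ smul_mem_smul ht mem_top⟩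
  exact Submodule.smul_mono_left hle hm

/-- In an MC multiplication semimodule with a nonzero element, the elements mapping `M` into
cyclic subsemimodules generate the unit ideal. -/
theorem IsMultiplicationSemimodule.span_cyclicMultipliers_eq_top
    {S M : Type*} [CommSemiring S] [AddCommMonoid M] [Module S M]
    (hMul : IsMultiplicationSemimodule S M) (hMC : IsMC S M) {x : M} (hx : x ≠ 0) :
    Ideal.span (cyclicMultipliers S M) = ⊤ := by
  obtain ⟨J, hJ⟩ := hMul (span S {x})
  have hJx : span S {x} = Ideal.span (cyclicMultipliers S M) • span S {x} := by
    rw [hJ, ← Submodule.mul_smul, mul_comm, Submodule.mul_smul,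
      hMul.span_cyclicMultipliers_smul_top]
  have hmem : x ∈ Ideal.span (cyclicMultipliers S M) • span S {x} :=
    hJx ▸ mem_span_singleton_self x
  obtain ⟨t, ht, htx⟩ := mem_smul_span_singleton.1 hmem
  rw [Ideal.eq_top_iff_one]
  exact hMC t 1 x hx (by rw [htx, one_smul]) ▸ ht

theorem smul_mem_ideal_smul_of_forall_smul_mem
    {S M : Type*} [CommSemiring S] [AddCommMonoid M] [Module S M]
    {I : Ideal S} {N : Submodule S M} {t : S} (ht : ∀ y : M, t • y ∈ N)
    {y : M} (hy : y ∈ I • (⊤ : Submodule S M)) : t • y ∈ I • N := by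
  induction hy using Submodule.smul_induction_on' with
  | smul r hr n _ => rw [smul_comm]; exact smul_mem_smul hr (ht n)
  | add y _ z _ hy hz => rw [smul_add]; exact add_mem hy hz

/-- A nonzero scalar acts without zero divisors on an MC semimodule. -/
theorem IsMC.smul_ne_zero {S M : Type*} [CommSemiring S] [AddCommMonoid M] [Module S M]
    (hMC : IsMC S M) {s : S} {x : M} (hs : s ≠ 0) (hx : x ≠ 0) : s • x ≠ 0 :=
  fun h => hs (hMC s 0 x hx (by rw [h, zero_smul]))

/-- Let `M` be an MC multiplication semimodule and `I` a weakly `1`-absorbing prime ideal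
of `S`. If `0 ≠ (a * b) • x ∈ I • M` for nonunits `a, b` and `x ∈ M`, then `a * b ∈ I` or
`x ∈ I • M`. -/
theorem mem_or_mem_of_smul_mem_ideal_smul_top_weakly
    {S M : Type*} [CommSemiring S] [Nontrivial S] [AddCommMonoid M] [Module S M]
    (hMC : IsMC S M) (hMul : IsMultiplicationSemimodule S M)
    (I : Ideal S) (hI : IsWeaklyOneAbsorbingPrimeIdeal I)
    (a b : S) (ha : ¬ IsUnit a) (hb : ¬ IsUnit b) (x : M)
    (hx : (a * b) • x ∈ I • (⊤ : Submodule S M)) (hx0 : (a * b) • x ≠ 0) :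
    a * b ∈ I ∨ x ∈ I • (⊤ : Submodule S M) := by
  have hx_ne : x ≠ 0 := fun h => hx0 (by rw [h, smul_zero])
  have hab : a * b ≠ 0 := fun h => hx0 (by rw [h, zero_smul])
  refine or_iff_not_imp_left.2 fun habI => ?_
  suffices hsq : ∀ t ∈ cyclicMultipliers S M, t ^ 2 • x ∈ I • (⊤ : Submodule S M) by
    have htop := Ideal.span_pow_eq_top _ (hMul.span_cyclicMultipliers_eq_top hMC hx_ne) 2
    have hle : Ideal.span ((· ^ 2) '' cyclicMultipliers S M) ≤
        (I • (⊤ : Submodule S M)).comap (LinearMap.toSpanSingleton S M x) :=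
      Ideal.span_le.2 (Set.image_subset_iff.2 hsq)
    have hone := hle (htop ▸ mem_top : (1 : S) ∈ _)
    simpa using hone
  rintro t ⟨m, hm⟩
  obtain ⟨s, hs⟩ := mem_span_singleton.1 (hm x)
  by_cases hm0 : m = 0
  · rw [pow_two, mul_smul, ← hs, hm0, smul_zero, smul_zero]
    exact zero_mem _
  obtain ⟨i, hi, him⟩ :=
    mem_smul_span_singleton.1 (smul_mem_ideal_smul_of_forall_smul_mem hm hx)
  have hi_eq : i = a * b * s := by
    refine hMC _ _ m hm0 ?_
    rw [him, mul_smul _ s, hs, smul_comm]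
  have habts : a * b * (t * s) ∈ I := by
    rw [mul_left_comm, ← hi_eq]
    exact I.mul_mem_left t hi
  have hts : t * s ∈ I := by
    by_cases hu : IsUnit (t * s)
    · exact absurd ((I.mul_unit_mem_iff_mem hu).1 habts) habI
    by_cases h0 : t * s = 0
    · rw [h0]
      exact zero_mem _
    refine (hI.2 a b (t * s) ha hb hu habts fun h => ?_).resolve_left habI
    refine hMC.smul_ne_zero hab (hMC.smul_ne_zero h0 hm0) ?_
    rw [← mul_smul, h, zero_smul]
  rw [pow_two, mul_smul, ← hs, ← mul_smul]
  exact smul_mem_smul hts mem_top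
end

section
/- Let S be a commutative semiring with 1 ≠ 0, M a unital S-semimodule, and x ∈ M such that the cyclic subsemimodule Sx is proper and subtractive, and such that the annihilator (0 :_S x) = {s ∈ S : s • x = 0} is contained in (Sx :_S M). Then Sx is a weakly 1-absorbing prime subsemimodule of M if and only if Sx is a 1-absorbing prime subsemimodule of M. -/
open Submodule

/-- Let `x ∈ M` be such that `Sx` is proper and subtractive and `(0 :_S x) ⊆ (Sx :_S M)`.
Then `Sx` is weakly `1`-absorbing prime if and only if it is `1`-absorbing prime. -/
theorem span_singleton_isWeaklyOneAbsorbingPrime_iff_isOneAbsorbingPrime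
    {S M : Type*} [CommSemiring S] [Nontrivial S] [AddCommMonoid M] [Module S M]
    (x : M) (hx : Submodule.span S {x} ≠ ⊤)
    (hsub : Subtractive (Submodule.span S {x}))
    (hann : ∀ s : S, s • x = 0 → s ∈ colonSM (Submodule.span S {x})) :
    IsWeaklyOneAbsorbingPrimeSubmodule (Submodule.span S {x}) ↔
      IsOneAbsorbingPrimeSubmodule (Submodule.span S {x}) := by
  refine ⟨fun h => ⟨hx, fun a b ha hb m hm => ?_⟩,
    fun h => ⟨hx, fun a b ha hb m hm _ => h.2 a b ha hb m hm⟩⟩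
  have hxN : x ∈ Submodule.span S {x} := Submodule.mem_span_singleton_self x
  by_cases hm0 : (a * b) • m = 0
  · by_cases hx0 : (a * b) • x = 0
    · exact Or.inl (hann _ hx0)
    · have key : (a * b) • (x + m) = (a * b) • x := by rw [smul_add, hm0, add_zero]
      exact (h.2 a b ha hb (x + m) (key ▸ Submodule.smul_mem _ _ hxN) (key ▸ hx0)).imp_right
        (hsub x m hxN)
  · exact h.2 a b ha hb m hm hm0
end

section
/- Let S be a local commutative semiring with 1 ≠ 0 and M a unital S-semimodule. Let N be a weakly 1-absorbing prime subtractive subsemimodule of M and let (a, b, m) be a triple-zero of N, i.e., a, b ∈ S are nonunits, m ∈ M, (a*b) • m = 0, a*b ∉ (N :_S M), and m ∉ N. Then: (a*b) • n = 0 for all n ∈ N; (a*t) • m = 0 and (b*t) • m = 0 for all t ∈ (N :_S M); (a*t) • n = 0 and (b*t) • n = 0 for all t ∈ (N :_S M) and all n ∈ N; and (s*t) • m = 0 for all s, t ∈ (N :_S M). -/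
open Submodule

theorem Subtractive.mem_colonSM_of_add_mem {S M : Type*} [CommSemiring S] [AddCommMonoid M]
    [Module S M] {N : Submodule S M} (hsub : Subtractive N) {u v : S} (hu : u ∈ colonSM N)
    (huv : u + v ∈ colonSM N) : v ∈ colonSM N := fun x =>
  hsub (u • x) (v • x) (hu x) (by rw [← add_smul]; exact huv x)

theorem not_isUnit_of_mem_colonSM {S M : Type*} [CommSemiring S] [AddCommMonoid M]
    [Module S M] {N : Submodule S M} {m : M} (hm : m ∉ N) {t : S} (ht : t ∈ colonSM N) :
    ¬ IsUnit t := by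
  rintro ⟨u, rfl⟩
  apply hm
  simpa [smul_smul] using N.smul_mem (↑u⁻¹ : S) (ht m)

/-- Perturbing the entries of a triple-zero by elements of `(N :_S M)` and of `N` leaves the
product zero. -/
theorem IsWeaklyOneAbsorbingPrimeSubmodule.perturbed_smul_eq_zero
    {S M : Type*} [CommSemiring S] [AddCommMonoid M] [Module S M]
    (hloc : IsLocalSemiring S) {N : Submodule S M}
    (hw : IsWeaklyOneAbsorbingPrimeSubmodule N) (hsub : Subtractive N)
    {a b : S} (ha : ¬ IsUnit a) (hb : ¬ IsUnit b) {m : M}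
    (h0 : (a * b) • m = 0) (hab : a * b ∉ colonSM N) (hm : m ∉ N)
    {s t : S} (hs : s ∈ colonSM N) (ht : t ∈ colonSM N) {n : M} (hn : n ∈ N) :
    ((a + s) * (b + t)) • (m + n) = 0 := by
  have hr : a * t + s * (b + t) ∈ colonSM N :=
    add_mem (Ideal.mul_mem_left _ a ht) (Ideal.mul_mem_right _ _ hs)
  have hst : (a + s) * (b + t) = a * t + s * (b + t) + a * b := by ring
  have hmem : ((a + s) * (b + t)) • (m + n) ∈ N := by
    rw [hst, add_smul, smul_add (a * b), h0, zero_add]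
    exact N.add_mem (hr _) (N.smul_mem _ hn)
  by_contra hne
  rcases hw.2 (a + s) (b + t) (hloc _ _ ha (not_isUnit_of_mem_colonSM hm hs))
    (hloc _ _ hb (not_isUnit_of_mem_colonSM hm ht)) _ hmem hne with h | h
  · rw [hst] at h
    exact hab (hsub.mem_colonSM_of_add_mem hr h)
  · exact hm (hsub n m hn (by rwa [add_comm]))

/-- Let `S` be a local semiring, `N` a weakly `1`-absorbing prime subtractive subsemimodule
of `M`, and `(a, b, m)` a triple-zero of `N`. Then `abN = a(N :_S M)m = b(N :_S M)m = 0` and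
`a(N :_S M)N = b(N :_S M)N = (N :_S M)²m = 0`. -/
theorem triple_zero_consequences
    {S M : Type*} [CommSemiring S] [Nontrivial S] [AddCommMonoid M] [Module S M]
    (hloc : IsLocalSemiring S) (N : Submodule S M)
    (hw : IsWeaklyOneAbsorbingPrimeSubmodule N) (hsub : Subtractive N)
    (a b : S) (ha : ¬ IsUnit a) (hb : ¬ IsUnit b) (m : M)
    (h0 : (a * b) • m = 0) (hab : a * b ∉ colonSM N) (hm : m ∉ N) :
    (∀ n ∈ N, (a * b) • n = 0) ∧
    (∀ t ∈ colonSM N, (a * t) • m = 0) ∧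
    (∀ t ∈ colonSM N, (b * t) • m = 0) ∧
    (∀ t ∈ colonSM N, ∀ n ∈ N, (a * t) • n = 0) ∧
    (∀ t ∈ colonSM N, ∀ n ∈ N, (b * t) • n = 0) ∧
    (∀ s ∈ colonSM N, ∀ t ∈ colonSM N, (s * t) • m = 0) := by
  have key {s t : S} (hs : s ∈ colonSM N) (ht : t ∈ colonSM N) {n : M} (hn : n ∈ N) :=
    hw.perturbed_smul_eq_zero hloc hsub ha hb h0 hab hm hs ht hn
  have hz : (0 : S) ∈ colonSM N := zero_mem _
  have habN : ∀ n ∈ N, (a * b) • n = 0 := fun n hn => by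
    simpa [h0] using key hz hz hn
  have hatm : ∀ t ∈ colonSM N, (a * t) • m = 0 := fun t ht => by
    simpa [mul_add, add_smul, h0] using key hz ht N.zero_mem
  have hbtm : ∀ t ∈ colonSM N, (b * t) • m = 0 := fun t ht => by
    simpa [add_mul, add_smul, h0, mul_comm t b] using key ht hz N.zero_mem
  refine ⟨habN, hatm, hbtm, fun t ht n hn => ?_, fun t ht n hn => ?_, fun s hs t ht => ?_⟩
  · simpa [mul_add, add_smul, h0, habN n hn, hatm t ht] using key hz ht hn
  · simpa [add_mul, add_smul, h0, habN n hn, hbtm t ht, mul_comm t b] using key ht hz hn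
  · simpa [add_mul, mul_add, add_smul, h0, hatm t ht, hbtm s hs, mul_comm s b] using
      key hs ht N.zero_mem
end
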